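/- arXiv:1002.3491 — 11 statements merged into one kernel-verified Lean document; each statement's English description precedes it below -/
import Mathlib

section
/- Let p : Y → X be a branched covering, i.e. an open continuous surjection of compact Hausdorff spaces such that the cardinalities of the fibers p⁻¹(x) are uniformly bounded over x ∈ X. Then for every point x ∈ X, writing p⁻¹(x) = {y₁, …, y_m} with the yᵢ pairwise distinct, there exist an open neighborhood U of x and pairwise disjoint open sets V₁, …, V_m with yₖ ∈ Vₖ, such that p⁻¹(U) = V₁ ∪ … ∪ V_m and moreover p(Vₖ) = U for every k = 1, …, m (the restriction of p to each Vₖ is surjective onto U). -/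
/-- **Proposition (surjective regular neighborhoods).** Let `p : Y → X` be a branched covering:
an open continuous surjection of compact Hausdorff spaces with uniformly bounded fiber
cardinalities.  Then every `x ∈ X`, with fiber `p⁻¹(x) = {y 1, …, y m}` (pairwise distinct),
admits an open neighborhood `U` and pairwise disjoint open sets `V k ∋ y k` with
`p ⁻¹ U = V 1 ∪ … ∪ V m` and `p (V k) = U` for every `k`. -/
theorem branched_covering_surjective_regular_neighborhood
    {X Y : Type*} [TopologicalSpace X] [TopologicalSpace Y]
    [CompactSpace X] [CompactSpace Y] [T2Space X] [T2Space Y]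
    {p : Y → X} (hcont : Continuous p) (hopen : IsOpenMap p) (hsurj : Function.Surjective p)
    (hfin : ∀ x, (p ⁻¹' {x}).Finite) {N : ℕ} (hbd : ∀ x, (p ⁻¹' {x}).ncard ≤ N) :
    ∀ (x : X) (m : ℕ) (y : Fin m → Y), Function.Injective y → p ⁻¹' {x} = Set.range y →
    ∃ (U : Set X) (V : Fin m → Set Y),
      IsOpen U ∧ x ∈ U ∧
      (∀ k, IsOpen (V k)) ∧ (∀ k, y k ∈ V k) ∧
      Pairwise (Function.onFun Disjoint V) ∧
      p ⁻¹' U = ⋃ k, V k ∧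
      ∀ k, p '' V k = U := by
  intro x m y hy hfib
  obtain ⟨W, hW, hdisj⟩ := (Set.finite_range y).t2_separation
  have hWopen : ∀ k, IsOpen (W (y k)) := fun k => (hW (y k)).2
  have hpy : ∀ k, p (y k) = x := fun k => by
    have hk : y k ∈ p ⁻¹' {x} := hfib ▸ Set.mem_range_self k
    exact hk
  have hclosed : IsClosed (p '' (⋃ k, W (y k))ᶜ) :=
    hcont.isClosedMap _ (isOpen_iUnion hWopen).isClosed_compl
  refine ⟨(⋂ k, p '' W (y k)) ∩ (p '' (⋃ k, W (y k))ᶜ)ᶜ,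
    fun k => W (y k) ∩ p ⁻¹' ((⋂ k, p '' W (y k)) ∩ (p '' (⋃ k, W (y k))ᶜ)ᶜ), ?_⟩
  have hU : IsOpen ((⋂ k, p '' W (y k)) ∩ (p '' (⋃ k, W (y k))ᶜ)ᶜ) :=
    (isOpen_iInter_of_finite fun k => hopen _ (hWopen k)).inter hclosed.isOpen_compl
  have hxU : x ∈ (⋂ k, p '' W (y k)) ∩ (p '' (⋃ k, W (y k))ᶜ)ᶜ := by
    refine ⟨Set.mem_iInter.2 fun k => ⟨y k, (hW (y k)).1, hpy k⟩, ?_⟩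
    rintro ⟨z, hz, hzx⟩
    have hzr : z ∈ Set.range y := hfib ▸ hzx
    obtain ⟨k, rfl⟩ := hzr
    exact hz (Set.mem_iUnion.2 ⟨k, (hW (y k)).1⟩)
  refine ⟨hU, hxU, fun k => (hWopen k).inter (hU.preimage hcont),
    fun k => ⟨(hW (y k)).1, ?_⟩, fun i j hij => ?_, ?_, fun k => ?_⟩
  · rwa [Set.mem_preimage, hpy k]
  · exact (hdisj (Set.mem_range_self i) (Set.mem_range_self j) (hy.ne hij)).mono
      Set.inter_subset_left Set.inter_subset_left
  · rw [← Set.iUnion_inter, eq_comm, Set.inter_eq_right]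
    intro z hz
    by_contra hzW
    exact hz.2 ⟨z, hzW, rfl⟩
  · rw [Set.image_inter_preimage, Set.inter_eq_right]
    exact fun z hz => Set.mem_iInter.1 hz.1 k
end

section
/- Let X be a compact Hausdorff space and x₀ ∈ X a non-isolated point (i.e. {x₀} is not open in X). Then the C(X,ℂ)-module C(X)₀ := {f ∈ C(X,ℂ) : f(x₀) = 0} is not finitely generated over C(X,ℂ). -/
/-- A radial square root on `ℂ`: it has modulus `√‖z‖` and the same argument as `z`. -/
noncomputable def radialSqrt (z : ℂ) : ℂ := z / (√‖z‖ : ℝ)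

lemma norm_radialSqrt (z : ℂ) : ‖radialSqrt z‖ = √‖z‖ := by
  rw [radialSqrt, norm_div, Complex.norm_real, Real.norm_of_nonneg (Real.sqrt_nonneg _),
    Real.div_sqrt]

lemma radialSqrt_mul_sqrt_norm (z : ℂ) : radialSqrt z * (√‖z‖ : ℝ) = z := by
  rcases eq_or_ne z 0 with rfl | hz
  · simp
  · have h : ((√‖z‖ : ℝ) : ℂ) ≠ 0 := by
      exact_mod_cast (Real.sqrt_pos.2 (norm_pos_iff.2 hz)).ne'
    exact div_mul_cancel₀ z h

lemma continuous_radialSqrt : Continuous radialSqrt := by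
  refine continuous_iff_continuousAt.2 fun z ↦ ?_
  rcases eq_or_ne z 0 with rfl | hz
  · have h : Filter.Tendsto (fun z : ℂ ↦ √‖z‖) (nhds 0) (nhds 0) :=
      Continuous.tendsto' (by fun_prop) _ _ (by simp)
    have h0 : radialSqrt 0 = 0 := by simp [radialSqrt]
    rw [ContinuousAt, h0]
    exact squeeze_zero_norm (fun z ↦ (norm_radialSqrt z).le) h
  · have h : ((√‖z‖ : ℝ) : ℂ) ≠ 0 := by
      exact_mod_cast (Real.sqrt_pos.2 (norm_pos_iff.2 hz)).ne'
    exact continuousAt_id.div (by fun_prop) h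

lemma mem_ker_evalAlgHom {X : Type*} [TopologicalSpace X] {x₀ : X} {f : C(X, ℂ)} :
    f ∈ RingHom.ker (ContinuousMap.evalAlgHom ℂ ℂ x₀).toRingHom ↔ f x₀ = 0 :=
  Iff.rfl

lemma isIdempotentElem_ker_evalAlgHom {X : Type*} [TopologicalSpace X] (x₀ : X) :
    IsIdempotentElem (RingHom.ker (ContinuousMap.evalAlgHom ℂ ℂ x₀).toRingHom :
      Ideal C(X, ℂ)) := by
  refine le_antisymm Ideal.mul_le_left fun f hf ↦ ?_
  rw [mem_ker_evalAlgHom] at hf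
  let g : C(X, ℂ) := ⟨fun x ↦ radialSqrt (f x), continuous_radialSqrt.comp f.continuous⟩
  let h : C(X, ℂ) := ⟨fun x ↦ (√‖f x‖ : ℝ), by fun_prop⟩
  have hgh : f = g * h := by
    ext x
    exact (radialSqrt_mul_sqrt_norm (f x)).symm
  rw [hgh]
  refine Ideal.mul_mem_mul (mem_ker_evalAlgHom.2 ?_) (mem_ker_evalAlgHom.2 ?_)
  · simp [g, hf, radialSqrt]
  · simp [h, hf]


/-- **Lemma.** Let `X` be a compact Hausdorff space and `x₀` a non-isolated point of `X`.
Then the ideal `C(X)₀ = {f ∈ C(X,ℂ) | f x₀ = 0}` is not finitely generated as a module over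
`C(X,ℂ)`. -/
theorem ideal_vanishing_at_nonisolated_point_not_fg
    {X : Type*} [TopologicalSpace X] [CompactSpace X] [T2Space X]
    (x₀ : X) (hx₀ : ¬ IsOpen ({x₀} : Set X)) :
    ¬ Ideal.FG (RingHom.ker (ContinuousMap.evalAlgHom ℂ ℂ x₀).toRingHom :
        Ideal C(X, ℂ)) := by
  intro hfg
  obtain ⟨e, he, hspan⟩ := (Ideal.isIdempotentElem_iff_of_fg _ hfg).1
    (isIdempotentElem_ker_evalAlgHom x₀)
  have he₀ : e x₀ = 0 := by
    rw [← mem_ker_evalAlgHom, hspan]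
    exact Ideal.mem_span_singleton_self e
  have hval (x : X) : e x = 0 ∨ e x = 1 :=
    IsIdempotentElem.iff_eq_zero_or_one.1 (DFunLike.congr_fun he x)
  have hzero (x : X) (hx : e x = 0) : x = x₀ := by
    by_contra hne
    obtain ⟨f, hf₀, hf₁, -⟩ := exists_continuous_zero_one_of_isClosed
      (isClosed_singleton (x := x₀)) (isClosed_singleton (x := x))
      (Set.disjoint_singleton.2 (Ne.symm hne))
    have hf₀' : f x₀ = 0 := hf₀ rfl
    have hf₁' : f x = 1 := hf₁ rfl
    let g : C(X, ℂ) := ⟨fun y ↦ (f y : ℂ), by fun_prop⟩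
    have hg : g ∈ RingHom.ker (ContinuousMap.evalAlgHom ℂ ℂ x₀).toRingHom :=
      mem_ker_evalAlgHom.2 (by simp [g, hf₀'])
    rw [hspan] at hg
    obtain ⟨a, ha⟩ := Ideal.mem_span_singleton.1 hg
    have := DFunLike.congr_fun ha x
    simp [g, hx, hf₁'] at this
  apply hx₀
  have hset : ({x₀} : Set X) = e ⁻¹' {1}ᶜ := by
    ext x
    simp only [Set.mem_singleton_iff, Set.mem_preimage, Set.mem_compl_iff]
    refine ⟨?_, fun h ↦ hzero x ((hval x).resolve_right h)⟩
    rintro rfl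
    simp [he₀]
  rw [hset]
  exact isOpen_compl_singleton.preimage e.continuous
end

section
/- Let X be a compact Hausdorff space and x₀ ∈ X a non-isolated point. Let Y be the quotient of X × {0,1} (where {0,1} carries the discrete topology) by the identification (x₀, 0) ~ (x₀, 1), i.e. two copies of X glued at x₀, and let p : Y → X be the induced fold map sending the class of (x, i) to x. Then C(Y,ℂ), regarded as a C(X,ℂ)-module via (ξ • f)(y) = ξ(p(y))·f(y), is not a finitely generated C(X,ℂ)-module. -/
/-- The setoid on `X × Bool` identifying `(x₀, false)` with `(x₀, true)`. -/
def glueRel {X : Type*} (x₀ : X) : Setoid (X × Bool) where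
  r a b := a = b ∨ (a.1 = x₀ ∧ b.1 = x₀)
  iseqv := by
    refine ⟨fun a => Or.inl rfl, ?_, ?_⟩
    · rintro a b (rfl | ⟨h1, h2⟩)
      · exact Or.inl rfl
      · exact Or.inr ⟨h2, h1⟩
    · rintro a b c (rfl | ⟨h1, h2⟩) h
      · exact h
      · rcases h with rfl | ⟨h3, h4⟩
        · exact Or.inr ⟨h1, h2⟩
        · exact Or.inr ⟨h1, h4⟩

/-- Two copies of `X` glued at the point `x₀`, with the quotient topology. -/
def GlueDouble (X : Type*) [TopologicalSpace X] (x₀ : X) : Type _ :=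
  Quotient (glueRel x₀)

instance (X : Type*) [TopologicalSpace X] (x₀ : X) : TopologicalSpace (GlueDouble X x₀) :=
  instTopologicalSpaceQuotient

/-- The fold map `GlueDouble X x₀ → X` sending the class of `(x, i)` to `x`. -/
def glueFold {X : Type*} [TopologicalSpace X] (x₀ : X) : C(GlueDouble X x₀, X) where
  toFun := Quotient.lift (fun a => a.1) (by
    rintro a b (rfl | ⟨h1, h2⟩)
    · rfl
    · show a.1 = b.1; rw [h1, h2])
  continuous_toFun := by
    exact continuous_fst.quotient_lift _

/-- `C(Y, ℂ)` as a module over `C(X, ℂ)` via `(ξ • f) y = ξ (p y) * f y`. -/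
noncomputable def pullbackModule {X Y : Type*} [TopologicalSpace X] [TopologicalSpace Y]
    (p : C(Y, X)) : Module C(X, ℂ) C(Y, ℂ) :=
  Module.compHom _ (ContinuousMap.compRightAlgHom ℂ ℂ p).toRingHom

/-- A real-valued continuous function vanishing at `x₀` is a difference of squares of continuous
functions vanishing at `x₀`. -/
theorem ofReal_mem_mul_self_of_mem_iff {X : Type*} [TopologicalSpace X] {x₀ : X}
    {I : Ideal C(X, ℂ)} (hI : ∀ f, f ∈ I ↔ f x₀ = 0) (u : C(X, ℝ)) (hu : u x₀ = 0) :
    (⟨fun x => (u x : ℂ), by fun_prop⟩ : C(X, ℂ)) ∈ I * I := by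
  let s : C(X, ℂ) := ⟨fun x => (Real.sqrt (u x) : ℂ), by fun_prop⟩
  let t : C(X, ℂ) := ⟨fun x => (Real.sqrt (-u x) : ℂ), by fun_prop⟩
  have hs : s ∈ I := (hI s).2 (by simp [s, hu])
  have ht : t ∈ I := (hI t).2 (by simp [t, hu])
  convert sub_mem (Ideal.mul_mem_mul hs hs) (Ideal.mul_mem_mul ht ht) using 1
  ext x
  simp only [ContinuousMap.coe_mk, ContinuousMap.sub_apply, ContinuousMap.mul_apply, s, t]
  norm_cast
  rcases le_total 0 (u x) with h | h
  · rw [Real.mul_self_sqrt h, Real.sqrt_eq_zero_of_nonpos (neg_nonpos.2 h)]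
    simp
  · rw [Real.mul_self_sqrt (neg_nonneg.2 h), Real.sqrt_eq_zero_of_nonpos h]
    simp

/-- The maximal ideal of functions vanishing at a point is idempotent. -/
theorem isIdempotentElem_of_mem_iff {X : Type*} [TopologicalSpace X] {x₀ : X}
    {I : Ideal C(X, ℂ)} (hI : ∀ f, f ∈ I ↔ f x₀ = 0) : IsIdempotentElem I := by
  refine le_antisymm Ideal.mul_le_left fun f hf => ?_
  have hf₀ := (hI f).1 hf
  have hre := ofReal_mem_mul_self_of_mem_iff hI ⟨fun x => (f x).re, by fun_prop⟩ (by simp [hf₀])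
  have him := ofReal_mem_mul_self_of_mem_iff hI ⟨fun x => (f x).im, by fun_prop⟩ (by simp [hf₀])
  convert add_mem hre (Ideal.mul_mem_right (ContinuousMap.const X Complex.I) _ him) using 1
  ext x
  simp

/-- If the ideal of functions vanishing at `x₀` is finitely generated, then `x₀` is isolated. -/
theorem isOpen_singleton_of_fg_of_mem_iff {X : Type*} [TopologicalSpace X] [CompactSpace X]
    [T2Space X] {x₀ : X} {I : Ideal C(X, ℂ)} (hI : ∀ f, f ∈ I ↔ f x₀ = 0) (hfg : I.FG) :
    IsOpen ({x₀} : Set X) := by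
  obtain ⟨e, he, rfl⟩ :=
    (Ideal.isIdempotentElem_iff_of_fg I hfg).1 (isIdempotentElem_of_mem_iff hI)
  have he₀ : e x₀ = 0 := (hI e).1 (Ideal.mem_span_singleton_self e)
  have h01 (x : X) : e x = 0 ∨ e x = 1 :=
    IsIdempotentElem.iff_eq_zero_or_one.1 (DFunLike.congr_fun he x)
  have hset : ({x₀} : Set X) = e ⁻¹' {1}ᶜ := by
    ext y
    simp only [Set.mem_singleton_iff, Set.mem_preimage, Set.mem_compl_iff]
    refine ⟨by rintro rfl; simp [he₀], fun hy => ?_⟩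
    by_contra hne
    obtain ⟨g, hg₀, hg₁, -⟩ := exists_continuous_zero_one_of_isClosed
      (isClosed_singleton (x := x₀)) (isClosed_singleton (x := y))
      (Set.disjoint_singleton.2 (Ne.symm hne))
    have hmem : (⟨fun x => (g x : ℂ), by fun_prop⟩ : C(X, ℂ)) ∈ Ideal.span {e} :=
      (hI _).2 (by simpa using hg₀ rfl)
    obtain ⟨a, ha⟩ := Ideal.mem_span_singleton'.1 hmem
    have hay := DFunLike.congr_fun ha y
    simp [(h01 y).resolve_right hy, hg₁ (Set.mem_singleton y)] at hay
  rw [hset]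
  exact isOpen_compl_singleton.preimage e.continuous

/-- The inclusion of one of the two copies of `X` in `GlueDouble X x₀`. -/
def glueIncl {X : Type*} [TopologicalSpace X] (x₀ : X) (b : Bool) : C(X, GlueDouble X x₀) where
  toFun x := Quotient.mk (glueRel x₀) (x, b)
  continuous_toFun := continuous_quotient_mk'.comp (by fun_prop)

/-- A function vanishing at `x₀`, extended by zero to the second copy of `X`. -/
noncomputable def glueExtend {X : Type*} [TopologicalSpace X] {x₀ : X} (g : C(X, ℂ)) (hg : g x₀ = 0) :
    C(GlueDouble X x₀, ℂ) where
  toFun := Quotient.lift (fun a : X × Bool => bif a.2 then 0 else g a.1) (by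
    rintro ⟨x, b⟩ ⟨y, c⟩ (h | ⟨h1, h2⟩)
    · rw [h]
    · dsimp only at h1 h2
      subst h1 h2
      cases b <;> cases c <;> simp [hg])
  continuous_toFun := by
    refine Continuous.quotient_lift ?_ _
    refine continuous_prod_of_discrete_right.2 fun b => ?_
    cases b
    · exact g.continuous
    · exact continuous_const

/-- **Lemma.** Let `X` be compact Hausdorff and `x₀ ∈ X` non-isolated.  Let `Y` be two copies of
`X` glued at `x₀` and `p : Y → X` the fold map.  Then `C(Y, ℂ)`, as a `C(X, ℂ)`-module via
`(ξ • f) y = ξ (p y) * f y`, is not finitely generated. -/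
theorem glueDouble_not_finitelyGenerated
    {X : Type*} [TopologicalSpace X] [CompactSpace X] [T2Space X]
    (x₀ : X) (hx₀ : ¬ IsOpen ({x₀} : Set X)) :
    letI := pullbackModule (glueFold x₀)
    ¬ Module.Finite C(X, ℂ) C(GlueDouble X x₀, ℂ) := by
  let _ := pullbackModule (glueFold x₀)
  intro hfin
  let D : C(GlueDouble X x₀, ℂ) →ₗ[C(X, ℂ)] C(X, ℂ) :=
    { toFun f := f.comp (glueIncl x₀ false) - f.comp (glueIncl x₀ true)
      map_add' f g := by
        ext x
        simp only [ContinuousMap.sub_apply, ContinuousMap.add_apply, ContinuousMap.comp_apply]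
        ring
      map_smul' ξ f := by
        ext x
        exact (mul_sub (ξ x) (f (glueIncl x₀ false x)) (f (glueIncl x₀ true x))).symm }
  refine hx₀ (isOpen_singleton_of_fg_of_mem_iff (I := LinearMap.range D) (fun g => ?_)
    (Module.Finite.iff_fg.1 (Module.Finite.range D)))
  constructor
  · rintro ⟨f, rfl⟩
    have h : glueIncl x₀ false x₀ = glueIncl x₀ true x₀ := Quotient.sound (Or.inr ⟨rfl, rfl⟩)
    change f (glueIncl x₀ false x₀) - f (glueIncl x₀ true x₀) = 0
    rw [h, sub_self]
  · intro hg
    refine ⟨glueExtend g hg, ?_⟩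
    ext x
    exact sub_zero (g x)
end

section
/- Let p : Y → X be a continuous map of compact Hausdorff spaces, let X' ⊆ X be a closed subset and Y' := p⁻¹(X'). If C(Y,ℂ) is a finitely generated module over C(X,ℂ) (with action (ξ • f)(y) = ξ(p(y))·f(y)), then C(Y',ℂ) is a finitely generated module over C(X',ℂ) (with action (ξ' • f')(y) = ξ'(p(y))·f'(y) for y ∈ Y'). -/
/-- The restriction `p⁻¹(X') → X'` of a continuous map `p : Y → X`. -/
def restrictPreimage {X Y : Type*} [TopologicalSpace X] [TopologicalSpace Y]
    (p : C(Y, X)) (X' : Set X) : C(↥(⇑p ⁻¹' X'), ↥X') where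
  toFun y := ⟨p y.1, y.2⟩
  continuous_toFun := (p.continuous.comp continuous_subtype_val).subtype_mk _

/-- Restriction of continuous functions to a closed subset of a normal space is surjective. -/
theorem compRightAlgHom_subtypeVal_surjective {X : Type*} [TopologicalSpace X] [NormalSpace X]
    {s : Set X} (hs : IsClosed s) :
    Function.Surjective
      (ContinuousMap.compRightAlgHom ℂ ℂ (⟨Subtype.val, continuous_subtype_val⟩ : C(s, X))) :=
  fun f ↦ f.exists_restrict_eq hs

/-- **Lemma.** Let `p : Y → X` be a continuous map of compact Hausdorff spaces, `X' ⊆ X`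
closed and `Y' := p⁻¹(X')`.  If `C(Y, ℂ)` is a finitely generated `C(X, ℂ)`-module, then
`C(Y', ℂ)` is a finitely generated `C(X', ℂ)`-module. -/
theorem restriction_finitelyGenerated
    {X Y : Type*} [TopologicalSpace X] [TopologicalSpace Y]
    [CompactSpace X] [CompactSpace Y] [T2Space X] [T2Space Y]
    (p : C(Y, X)) (X' : Set X) (hX' : IsClosed X') :
    letI := pullbackModule p
    letI := pullbackModule (restrictPreimage p X')
    Module.Finite C(X, ℂ) C(Y, ℂ) → Module.Finite C(↥X', ℂ) C(↥(⇑p ⁻¹' X'), ℂ) := by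
  let := pullbackModule p
  let := pullbackModule (restrictPreimage p X')
  intro hfin
  let σ : C(X, ℂ) →+* C(↥X', ℂ) :=
    (ContinuousMap.compRightAlgHom ℂ ℂ ⟨Subtype.val, continuous_subtype_val⟩).toRingHom
  have : RingHomSurjective σ := ⟨compRightAlgHom_subtypeVal_surjective hX'⟩
  let restr : C(Y, ℂ) →ₛₗ[σ] C(↥(⇑p ⁻¹' X'), ℂ) :=
    { toFun := ContinuousMap.compRightAlgHom ℂ ℂ ⟨Subtype.val, continuous_subtype_val⟩
      map_add' := map_add _
      map_smul' := fun _ _ ↦ rfl }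
  exact Module.Finite.of_surjective restr
    (compRightAlgHom_subtypeVal_surjective (hX'.preimage p.continuous))
end

section
/- Let p : Y → X be a continuous map of compact Hausdorff spaces, let X' ⊆ X be closed and Y' := p⁻¹(X'). If C(Y,ℂ) is a finitely generated projective module over C(X,ℂ) (with action (ξ • f)(y) = ξ(p(y))·f(y)), then C(Y',ℂ) is a finitely generated projective module over C(X',ℂ) (with action (ξ' • f')(y) = ξ'(p(y))·f'(y) for y ∈ Y'). -/
theorem LinearMap.apply_eq_sum_smul_single {R M ι : Type*} [Semiring R] [AddCommMonoid M]
    [Module R M] [Fintype ι] [DecidableEq ι] (f : (ι → R) →ₗ[R] M) (v : ι → R) :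
    f v = ∑ i, v i • f (Pi.single i 1) := by
  conv_lhs => rw [pi_eq_sum_univ' v]
  simp

theorem pullbackModule_smul_def {X Y : Type*} [TopologicalSpace X] [TopologicalSpace Y]
    (p : C(Y, X)) (ξ : C(X, ℂ)) (f : C(Y, ℂ)) :
    letI := pullbackModule p
    ξ • f = ξ.comp p * f :=
  rfl

/-- A `C(X, ℂ)`-linear functional on a finitely generated `C(Y, ℂ)` is automatically continuous. -/
theorem continuous_of_finite_pullbackModule {X Y : Type*} [TopologicalSpace X]
    [TopologicalSpace Y] [CompactSpace X] [CompactSpace Y] (p : C(Y, X)) :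
    letI := pullbackModule p
    Module.Finite C(X, ℂ) C(Y, ℂ) → ∀ φ : C(Y, ℂ) →ₗ[C(X, ℂ)] C(X, ℂ), Continuous φ := by
  let := pullbackModule p
  intro hfin φ
  obtain ⟨n, s, hs⟩ := Module.Finite.exists_fin' C(X, ℂ) C(Y, ℂ)
  have hs_apply (v : Fin n → C(X, ℂ)) :
      s v = ∑ i, (v i).comp p * s (Pi.single i 1) := by
    simpa only [pullbackModule_smul_def] using LinearMap.apply_eq_sum_smul_single s v
  have hφs_apply (v : Fin n → C(X, ℂ)) :
      φ (s v) = ∑ i, v i * φ (s (Pi.single i 1)) :=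
    LinearMap.apply_eq_sum_smul_single (φ ∘ₗ s) v
  let S : (Fin n → C(X, ℂ)) →L[ℂ] C(Y, ℂ) :=
    { toFun := s
      map_add' := map_add s
      map_smul' := fun c v => by
        rw [hs_apply, hs_apply, RingHom.id_apply, Finset.smul_sum]
        refine Finset.sum_congr rfl fun i _ => ?_
        ext y
        simp
      cont := by
        rw [show (s : (Fin n → C(X, ℂ)) → C(Y, ℂ)) = _ from funext hs_apply]
        exact continuous_finsetSum _ fun i _ =>
          ((ContinuousMap.continuous_precomp p).comp (continuous_apply i)).mul continuous_const }
  have hS : Topology.IsQuotientMap S := S.isQuotientMap hs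
  rw [hS.continuous_iff]
  change Continuous fun v => φ (s v)
  rw [funext hφs_apply]
  fun_prop

/-- Functions vanishing on `p⁻¹(X')` are uniform limits of multiples `ξ • F` with `ξ` vanishing
on `X'`. -/
theorem exists_norm_sub_comp_mul_lt {X Y : Type*} [TopologicalSpace X] [TopologicalSpace Y]
    [CompactSpace X] [CompactSpace Y] [T2Space X] (p : C(Y, X)) {X' : Set X}
    (hX' : IsClosed X') {F : C(Y, ℂ)} (hF : ∀ y, p y ∈ X' → F y = 0) {ε : ℝ} (hε : 0 < ε) :
    ∃ ξ : C(X, ℂ), (∀ x ∈ X', ξ x = 0) ∧ ‖F - ξ.comp p * F‖ < ε := by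
  have hK : IsClosed {y | ε / 2 ≤ ‖F y‖} := isClosed_le (by fun_prop) (by fun_prop)
  have hpK : IsClosed (p '' {y | ε / 2 ≤ ‖F y‖}) := (hK.isCompact.image p.continuous).isClosed
  have hdisj : Disjoint X' (p '' {y | ε / 2 ≤ ‖F y‖}) := by
    rw [Set.disjoint_right]
    rintro _ ⟨y, hy, rfl⟩ hx
    rw [Set.mem_ofPred_eq, hF y hx, norm_zero] at hy
    linarith
  obtain ⟨u, hu0, hu1, hu⟩ := exists_continuous_zero_one_of_isClosed hX' hpK hdisj
  refine ⟨⟨fun x => (u x : ℂ), by fun_prop⟩, fun x hx => by simp [hu0 hx], ?_⟩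
  refine lt_of_le_of_lt ((ContinuousMap.norm_le _ (half_pos hε).le).2 fun y => ?_)
    (half_lt_self hε)
  have hy : (F - (⟨fun x => (u x : ℂ), by fun_prop⟩ : C(X, ℂ)).comp p * F) y
      = ((1 - u (p y) : ℝ) : ℂ) * F y := by
    simp [sub_mul]
  rw [hy, norm_mul, Complex.norm_real, Real.norm_eq_abs, abs_of_nonneg (by linarith [(hu (p y)).2])]
  by_cases h : ε / 2 ≤ ‖F y‖
  · have : u (p y) = 1 := hu1 ⟨y, h, rfl⟩
    simpa [this] using (half_pos hε).le
  · nlinarith [(hu (p y)).1, norm_nonneg (F y)]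

/-- The restriction of `φ F` to `X'` depends only on the restriction of `F` to `p⁻¹(X')`. -/
theorem functional_eqOn_of_eqOn_preimage {X Y : Type*} [TopologicalSpace X]
    [TopologicalSpace Y] [CompactSpace X] [CompactSpace Y] [T2Space X] (p : C(Y, X))
    {X' : Set X} (hX' : IsClosed X') :
    letI := pullbackModule p
    Module.Finite C(X, ℂ) C(Y, ℂ) → ∀ (φ : C(Y, ℂ) →ₗ[C(X, ℂ)] C(X, ℂ)) {F G : C(Y, ℂ)},
      Set.EqOn F G (p ⁻¹' X') → Set.EqOn (φ F) (φ G) X' := by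
  let := pullbackModule p
  intro hfin φ F G hFG x hx
  have hφ := continuous_of_finite_pullbackModule p hfin φ
  have hclosed : IsClosed {H : C(Y, ℂ) | φ H x = 0} :=
    isClosed_eq ((continuous_eval_const x).comp hφ) continuous_const
  have hmem : F - G ∈ closure {H : C(Y, ℂ) | φ H x = 0} := by
    refine Metric.mem_closure_iff.2 fun ε hε => ?_
    obtain ⟨ξ, hξ, hlt⟩ := exists_norm_sub_comp_mul_lt p hX' (F := F - G)
      (fun y hy => by simp [hFG hy]) hε
    refine ⟨ξ.comp p * (F - G), ?_, by rwa [dist_eq_norm]⟩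
    rw [Set.mem_ofPred_eq, ← pullbackModule_smul_def, map_smul]
    simp [hξ x hx]
  rw [hclosed.closure_eq, Set.mem_ofPred_eq, map_sub, ContinuousMap.sub_apply] at hmem
  exact sub_eq_zero.1 hmem

/-- **Lemma.** Let `p : Y → X` be a continuous map of compact Hausdorff spaces, `X' ⊆ X`
closed and `Y' := p⁻¹(X')`.  If `C(Y, ℂ)` is a finitely generated projective
`C(X, ℂ)`-module, then `C(Y', ℂ)` is a finitely generated projective `C(X', ℂ)`-module. -/
theorem restriction_finitelyGenerated_projective
    {X Y : Type*} [TopologicalSpace X] [TopologicalSpace Y]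
    [CompactSpace X] [CompactSpace Y] [T2Space X] [T2Space Y]
    (p : C(Y, X)) (X' : Set X) (hX' : IsClosed X') :
    letI := pullbackModule p
    letI := pullbackModule (restrictPreimage p X')
    Module.Finite C(X, ℂ) C(Y, ℂ) → Module.Projective C(X, ℂ) C(Y, ℂ) →
      Module.Finite C(↥X', ℂ) C(↥(⇑p ⁻¹' X'), ℂ) ∧
      Module.Projective C(↥X', ℂ) C(↥(⇑p ⁻¹' X'), ℂ) := by
  let := pullbackModule p
  let := pullbackModule (restrictPreimage p X')
  intro hfin hproj
  obtain ⟨n, f, g, -, -, hfg⟩ := Module.Finite.exists_comp_eq_id_of_projective C(X, ℂ) C(Y, ℂ)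
  have hY' : IsClosed (p ⁻¹' X') := hX'.preimage p.continuous
  choose extY hextY using fun h : C(↥(p ⁻¹' X'), ℂ) => h.exists_restrict_eq hY'
  choose extX hextX using fun h : C(↥X', ℂ) => h.exists_restrict_eq hX'
  have extY_apply (h : C(↥(p ⁻¹' X'), ℂ)) (y : Y) (hy : y ∈ p ⁻¹' X') :
      extY h y = h ⟨y, hy⟩ := DFunLike.congr_fun (hextY h) ⟨y, hy⟩
  have extX_apply (h : C(↥X', ℂ)) (x : X) (hx : x ∈ X') :
      extX h x = h ⟨x, hx⟩ := DFunLike.congr_fun (hextX h) ⟨x, hx⟩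
  have hg (i : Fin n) {F G : C(Y, ℂ)} (hFG : Set.EqOn F G (p ⁻¹' X')) (x : ↥X') :
      g F i x = g G i x :=
    functional_eqOn_of_eqOn_preimage p hX' hfin (LinearMap.proj i ∘ₗ g) hFG x.2
  let g' : C(↥(p ⁻¹' X'), ℂ) →ₗ[C(↥X', ℂ)] (Fin n → C(↥X', ℂ)) :=
    { toFun := fun h i => (g (extY h) i).restrict X'
      map_add' := fun h k => by
        ext i x
        have := hg i (F := extY (h + k)) (G := extY h + extY k)
          (fun y hy => by simp [extY_apply _ y hy]) x
        simpa using this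
      map_smul' := fun ξ h => by
        ext i x
        have := hg i (F := extY (ξ • h)) (G := extX ξ • extY h)
          (fun y hy => by
            rw [extY_apply _ y hy]
            change ξ ⟨p y, hy⟩ * h ⟨y, hy⟩ = extX ξ (p y) * extY h y
            rw [extX_apply _ _ hy, extY_apply _ y hy]) x
        simpa [extX_apply _ x.1 x.2] using this }
  let f' : (Fin n → C(↥X', ℂ)) →ₗ[C(↥X', ℂ)] C(↥(p ⁻¹' X'), ℂ) :=
    Fintype.linearCombination C(↥X', ℂ) fun i => (f (Pi.single i 1)).restrict (p ⁻¹' X')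
  have hfg' : f' ∘ₗ g' = LinearMap.id := by
    ext h y
    have key : ∑ i, g (extY h) i • f (Pi.single i 1) = extY h := by
      rw [← LinearMap.apply_eq_sum_smul_single, ← LinearMap.comp_apply, hfg, LinearMap.id_apply]
    have key_y : (∑ i, g (extY h) i • f (Pi.single i 1)) y.1 = h y := by
      rw [key, extY_apply h y.1 y.2]
    rw [← LinearMap.id_apply (R := C(↥X', ℂ)) h] at key_y
    rw [← key_y]
    simp only [f', LinearMap.comp_apply, Fintype.linearCombination_apply, ContinuousMap.sum_apply]
    rfl
  exact ⟨Module.Finite.of_surjective f' (LinearMap.surjective_of_comp_eq_id g' f' hfg'),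
    Module.Projective.of_split g' f' hfg'⟩
end

section
/- Let X be a compact Hausdorff space and x ∈ X a non-isolated point. Regard ℂ as a C(X,ℂ)-module via the action ξ • z := ξ(x)·z (restriction of scalars along the evaluation character at x). Then ℂ is a finitely generated C(X,ℂ)-module, but it is not a projective C(X,ℂ)-module. -/
/-- **Lemma.** Let `X` be a compact Hausdorff space and `x` a non-isolated point.  Regard `ℂ`
as a `C(X, ℂ)`-module via `ξ • z = ξ x * z`.  Then `ℂ` is a finitely generated
`C(X, ℂ)`-module which is not projective. -/
theorem evaluation_module_fg_not_projective
    {X : Type*} [TopologicalSpace X] [CompactSpace X] [T2Space X]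
    (x : X) (hx : ¬ IsOpen ({x} : Set X)) :
    letI : Module C(X, ℂ) ℂ := Module.compHom ℂ (ContinuousMap.evalAlgHom ℂ ℂ x).toRingHom
    Module.Finite C(X, ℂ) ℂ ∧ ¬ Module.Projective C(X, ℂ) ℂ := by
  let : Module C(X, ℂ) ℂ := Module.compHom ℂ (ContinuousMap.evalAlgHom ℂ ℂ x).toRingHom
  have smul_def (ξ : C(X, ℂ)) (z : ℂ) : ξ • z = ξ x * z := rfl
  have hsurj : Function.Surjective (LinearMap.toSpanSingleton C(X, ℂ) ℂ 1) := fun z =>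
    ⟨ContinuousMap.const X z, by simp [smul_def]⟩
  refine ⟨Module.Finite.of_surjective _ hsurj, fun hproj => hx ?_⟩
  obtain ⟨s, hs⟩ := Module.projective_lifting_property
    (LinearMap.toSpanSingleton C(X, ℂ) ℂ 1) LinearMap.id hsurj
  have he : s 1 x = 1 := by
    simpa [smul_def] using LinearMap.congr_fun hs 1
  have he0 (y : X) (hy : y ≠ x) : s 1 y = 0 := by
    obtain ⟨f, hf0, hf1, -⟩ := exists_continuous_zero_one_of_isClosed
      (isClosed_singleton (x := x)) (isClosed_singleton (x := y)) (by simpa using hy.symm)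
    let ξ : C(X, ℂ) := ⟨fun t => (f t : ℂ), by fun_prop⟩
    have hξx : ξ x = 0 := by simpa [ξ] using hf0 rfl
    have hξy : ξ y = 1 := by simpa [ξ] using hf1 rfl
    have h : ξ • s 1 = 0 := by rw [← map_smul, smul_def, hξx, zero_mul, map_zero]
    simpa [hξy] using DFunLike.congr_fun h y
  have hset : {x} = {y | s 1 y ≠ 0} := by
    ext y
    refine ⟨?_, fun hy => not_imp_comm.mp (he0 y) hy⟩
    rintro rfl
    simp [he]
  rw [hset]
  exact isOpen_ne_fun (map_continuous _) continuous_const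
end

section
/- Let X = ℝ/ℤ be the circle (the additive circle AddCircle 1), let Y = [0,1] ⊆ ℝ, and let p : Y → X be the restriction of the quotient map ℝ → ℝ/ℤ (so p identifies the two endpoints of [0,1]). Regard C(Y,ℂ) as a C(X,ℂ)-module via (ξ • f)(t) = ξ(p(t))·f(t). Then C(Y,ℂ) is a finitely generated C(X,ℂ)-module (in fact generated by two elements), but it is not a projective C(X,ℂ)-module. -/
/-- The map `[0, 1] → ℝ/ℤ` restricting the quotient map, identifying the two endpoints. -/
noncomputable def circleFold : C(↥(Set.Icc (0 : ℝ) 1), AddCircle (1 : ℝ)) where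
  toFun t := (t.1 : AddCircle (1 : ℝ))
  continuous_toFun := (AddCircle.continuous_mk' 1).comp continuous_subtype_val

theorem circleFold_one : circleFold 1 = circleFold 0 :=
  (AddCircle.coe_period (1 : ℝ)).trans (QuotientAddGroup.mk_zero _).symm

/-- A continuous function on `[0, 1]` with equal values at the endpoints descends to the circle. -/
theorem exists_comp_circleFold_eq (h : C(↥(Set.Icc (0 : ℝ) 1), ℂ)) (h01 : h 0 = h 1) :
    ∃ ξ : C(AddCircle (1 : ℝ), ℂ), ∀ t, ξ (circleFold t) = h t := by
  have : Fact ((0 : ℝ) < 1) := ⟨one_pos⟩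
  have hext (t : ↥(Set.Icc (0 : ℝ) 1)) : Set.IccExtend zero_le_one h t.1 = h t :=
    Set.IccExtend_val _ _ t
  refine ⟨⟨AddCircle.liftIco 1 0 (Set.IccExtend zero_le_one h),
    AddCircle.liftIco_zero_continuous (by simpa using h01)
      (h.continuous.Icc_extend').continuousOn⟩, fun t ↦ ?_⟩
  change AddCircle.liftIco 1 0 (Set.IccExtend zero_le_one h) ((t.1 : ℝ) : AddCircle (1 : ℝ)) = h t
  rcases t.2.2.lt_or_eq with ht | ht
  · rw [AddCircle.liftIco_zero_coe_apply ⟨t.2.1, ht⟩, hext]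
  · obtain rfl : t = 1 := Subtype.ext ht
    change AddCircle.liftIco 1 0 (Set.IccExtend zero_le_one h) (circleFold 1) = h 1
    rw [circleFold_one, ← h01]
    exact (AddCircle.liftIco_zero_coe_apply ⟨le_rfl, one_pos⟩).trans (hext 0)

/-- The inclusion `[0, 1] → ℂ`. -/
noncomputable def iccInclusion : C(↥(Set.Icc (0 : ℝ) 1), ℂ) where
  toFun t := ((t : ℝ) : ℂ)
  continuous_toFun := by fun_prop

theorem pullbackModule_smul_apply {X Y : Type*} [TopologicalSpace X] [TopologicalSpace Y]
    (p : C(Y, X)) (ξ : C(X, ℂ)) (f : C(Y, ℂ)) (y : Y) :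
    letI := pullbackModule p
    (ξ • f) y = ξ (p y) * f y :=
  rfl

theorem span_one_iccInclusion :
    letI := pullbackModule circleFold
    Submodule.span C(AddCircle (1 : ℝ), ℂ) {1, iccInclusion} = ⊤ := by
  let := pullbackModule circleFold
  refine eq_top_iff.2 fun h _ ↦ Submodule.mem_span_pair.2 ?_
  let k : C(↥(Set.Icc (0 : ℝ) 1), ℂ) := h - ContinuousMap.const _ (h 1 - h 0) * iccInclusion
  obtain ⟨ξ, hξ⟩ := exists_comp_circleFold_eq k (by simp [k, iccInclusion])
  refine ⟨ξ, ContinuousMap.const _ (h 1 - h 0), ContinuousMap.ext fun t ↦ ?_⟩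
  rw [ContinuousMap.add_apply, pullbackModule_smul_apply, pullbackModule_smul_apply, hξ]
  simp [k]

/-- Every `C(ℝ/ℤ, ℂ)`-linear functional on `C([0, 1], ℂ)` sends `1` to a function vanishing at
the base point. -/
theorem circleFold_functional_one_apply_zero :
    letI := pullbackModule circleFold
    ∀ φ : C(↥(Set.Icc (0 : ℝ) 1), ℂ) →ₗ[C(AddCircle (1 : ℝ), ℂ)] C(AddCircle (1 : ℝ), ℂ),
      φ 1 (circleFold 0) = 0 := by
  let := pullbackModule circleFold
  intro φ
  obtain ⟨ξ, hξ⟩ := exists_comp_circleFold_eq (iccInclusion * (1 - iccInclusion))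
    (by simp [iccInclusion])
  obtain ⟨η, hη⟩ := exists_comp_circleFold_eq (iccInclusion * (1 - iccInclusion) * iccInclusion)
    (by simp [iccInclusion])
  have hsmul : ξ • iccInclusion = η • (1 : C(↥(Set.Icc (0 : ℝ) 1), ℂ)) := by
    ext t
    rw [pullbackModule_smul_apply, pullbackModule_smul_apply, hξ, hη]
    simp
  have hφ : ξ * φ iccInclusion = η * φ 1 := by
    simpa only [map_smul, smul_eq_mul] using congrArg φ hsmul
  have hdense : Dense ({0, 1}ᶜ : Set ↥(Set.Icc (0 : ℝ) 1)) := by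
    rw [Set.compl_eq_univ_sdiff]
    exact dense_univ.sdiff_finite (Set.toFinite _)
  have heq : (fun t ↦ φ iccInclusion (circleFold t)) =
      fun t ↦ iccInclusion t * φ 1 (circleFold t) := by
    refine Continuous.ext_on hdense (by fun_prop) (by fun_prop) fun t ht ↦ ?_
    have h := DFunLike.congr_fun hφ (circleFold t)
    simp only [ContinuousMap.mul_apply, hξ, hη, mul_assoc] at h
    have ht0 : iccInclusion t ≠ 0 := fun h0 ↦ ht (Or.inl (Subtype.ext (by
      simpa [iccInclusion] using h0)))
    have ht1 : (1 - iccInclusion) t ≠ 0 := fun h1 ↦ ht (Or.inr (Subtype.ext (by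
      have h2 : (1 : ℂ) = ((t : ℝ) : ℂ) := sub_eq_zero.1 h1
      exact_mod_cast h2.symm)))
    exact mul_left_cancel₀ ht1 (mul_left_cancel₀ ht0 h)
  have h0 := congrFun heq 0
  have h1 := congrFun heq 1
  simp only [circleFold_one] at h1
  simp only [h0] at h1
  simpa [iccInclusion] using h1.symm

/-- **Example.** Let `X = ℝ/ℤ` be the circle, `Y = [0, 1]`, and `p : Y → X` the restriction of
the quotient map.  Then `C(Y, ℂ)` is a finitely generated `C(X, ℂ)`-module (in fact generated
by two elements), but it is not projective. -/
theorem interval_over_circle_fg_not_projective :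
    letI := pullbackModule circleFold
    Module.Finite C(AddCircle (1 : ℝ), ℂ) C(↥(Set.Icc (0 : ℝ) 1), ℂ) ∧
    (∃ f g : C(↥(Set.Icc (0 : ℝ) 1), ℂ),
      Submodule.span C(AddCircle (1 : ℝ), ℂ) {f, g} = ⊤) ∧
    ¬ Module.Projective C(AddCircle (1 : ℝ), ℂ) C(↥(Set.Icc (0 : ℝ) 1), ℂ) := by
  let := pullbackModule circleFold
  refine ⟨⟨Submodule.fg_def.2 ⟨{1, iccInclusion}, Set.toFinite _, span_one_iccInclusion⟩⟩,
    ⟨1, iccInclusion, span_one_iccInclusion⟩, fun ⟨s, hs⟩ ↦ ?_⟩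
  have h := DFunLike.congr_fun (hs 1) 0
  rw [Finsupp.linearCombination_apply, Finsupp.sum, ContinuousMap.sum_apply,
    Finset.sum_eq_zero fun m _ ↦ ?_] at h
  · exact zero_ne_one h
  · rw [pullbackModule_smul_apply]
    have := circleFold_functional_one_apply_zero (Finsupp.lapply m ∘ₗ s)
    rw [LinearMap.comp_apply, Finsupp.lapply_apply] at this
    rw [this, zero_mul]
end

section
/- Let X and Y be connected compact Hausdorff spaces and p : Y → X a continuous surjection. If C(Y,ℂ), regarded as a C(X,ℂ)-module via the action (ξ • f)(y) = ξ(p(y))·f(y), is a finitely generated projective module, then p is a finite-fold covering map: every fiber p⁻¹(x) is finite, all fibers have the same cardinality, and every point of X has an open neighborhood U such that p⁻¹(U) is a disjoint union of open sets each mapped homeomorphically onto U by p. -/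
open Topology

/-- Continuous functions on a compact Hausdorff space interpolate arbitrary values on a
finite set. -/
theorem exists_continuousMap_eqOn_finset {Y : Type*} [TopologicalSpace Y] [CompactSpace Y]
    [T2Space Y] (s : Finset Y) (v : Y → ℂ) : ∃ g : C(Y, ℂ), ∀ y ∈ s, g y = v y := by
  obtain ⟨g, hg⟩ := ContinuousMap.exists_restrict_eq (s := (s : Set Y)) s.finite_toSet.isClosed
    (⟨fun y => v y, continuous_of_discreteTopology⟩ : C((s : Set Y), ℂ))
  exact ⟨g, fun y hy => DFunLike.congr_fun hg ⟨y, hy⟩⟩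

/-- The dual basis of a finitely generated projective `C(X, ℂ)`-module `C(Y, ℂ)`, with
continuous coordinate functionals. -/
theorem exists_continuous_dual_basis {X Y : Type*} [TopologicalSpace X] [TopologicalSpace Y]
    [CompactSpace X] [CompactSpace Y] (p : C(Y, X))
    (hfin : letI := pullbackModule p; Module.Finite C(X, ℂ) C(Y, ℂ))
    (hproj : letI := pullbackModule p; Module.Projective C(X, ℂ) C(Y, ℂ)) :
    ∃ (n : ℕ) (f : Fin n → C(Y, ℂ)) (φ : Fin n → C(Y, ℂ) →L[ℂ] C(X, ℂ)),
      (∀ i (ξ : C(X, ℂ)) (g : C(Y, ℂ)), φ i (ξ.comp p * g) = ξ * φ i g) ∧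
      ∀ g : C(Y, ℂ), ∑ i, (φ i g).comp p * f i = g := by
  let := pullbackModule p
  obtain ⟨n, F, G, hF, -, hFG⟩ := Module.Finite.exists_comp_eq_id_of_projective C(X, ℂ) C(Y, ℂ)
  have smul_def (ξ : C(X, ℂ)) (g : C(Y, ℂ)) : ξ • g = ξ.comp p * g := rfl
  have F_apply (a : Fin n → C(X, ℂ)) : F a = ∑ i, (a i).comp p * F (Pi.single i 1) := by
    simp_rw [← smul_def, ← map_smul, ← map_sum]
    congr 1
    ext1 j
    simp [Finset.sum_apply, Pi.single_apply]
  have G_mul (ξ : C(X, ℂ)) (g : C(Y, ℂ)) : G (ξ.comp p * g) = ξ • G g := by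
    rw [← smul_def, map_smul]
  let Fc : (Fin n → C(X, ℂ)) →L[ℂ] C(Y, ℂ) :=
    { toFun := F
      map_add' := map_add F
      map_smul' := fun c a => by
        have : c • a = ContinuousMap.const X c • a := by
          ext; simp
        rw [this, map_smul, smul_def]
        ext; simp
      cont := by
        refine (continuous_congr F_apply).2 ?_
        refine continuous_finsetSum _ fun i _ => Continuous.mul ?_ continuous_const
        exact (ContinuousMap.continuous_precomp p).comp (continuous_apply i) }
  have hquot : IsQuotientMap Fc := Fc.isQuotientMap hF
  have smul_G (c : ℂ) (g : C(Y, ℂ)) : G (c • g) = c • G g := by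
    have : c • g = (ContinuousMap.const X c).comp p * g := by ext; simp
    rw [this, G_mul]
    ext; simp
  have hGF (a : Fin n → C(X, ℂ)) (i : Fin n) :
      G (F a) i = ∑ j, a j * G (F (Pi.single j 1)) i := by
    conv_lhs => rw [F_apply, map_sum, Finset.sum_apply]
    simp_rw [G_mul]
    rfl
  refine ⟨n, fun i => F (Pi.single i 1), fun i =>
    { toFun := fun g => G g i
      map_add' := by simp
      map_smul' := fun c g => by simp [smul_G]
      cont := ?_ }, fun i ξ g => ?_, fun g => ?_⟩
  · refine hquot.continuous_iff.2 ?_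
    refine (continuous_congr fun a => hGF a i).2 ?_
    fun_prop
  · exact congr_fun (G_mul ξ g) i
  · exact (F_apply (G g)).symm.trans (LinearMap.congr_fun hFG g)

/-- A continuous `C(X, ℂ)`-linear map `C(Y, ℂ) → C(X, ℂ)` is local over `X`. -/
theorem apply_eq_zero_of_eqOn_fiber {X Y : Type*} [TopologicalSpace X] [TopologicalSpace Y]
    [CompactSpace X] [CompactSpace Y] [T2Space X] (p : C(Y, X)) (φ : C(Y, ℂ) →L[ℂ] C(X, ℂ))
    (hφ : ∀ (ξ : C(X, ℂ)) (g : C(Y, ℂ)), φ (ξ.comp p * g) = ξ * φ g)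
    {x : X} {g : C(Y, ℂ)} (hg : ∀ y, p y = x → g y = 0) : φ g x = 0 := by
  have key (ε : ℝ) (hε : 0 < ε) : ‖φ g x‖ ≤ ‖φ‖ * ε := by
    have hK : IsClosed {y | ε ≤ ‖g y‖} := isClosed_le continuous_const (by fun_prop)
    obtain ⟨ξ, hξ0, hξ1, hξ⟩ := exists_continuous_zero_one_of_isClosed
      (isClosed_singleton (x := x)) (p.continuous.isClosedMap _ hK) (by
        rw [Set.disjoint_singleton_left]
        rintro ⟨y, hy, hyx⟩
        rw [Set.mem_ofPred_eq, hg y hyx, norm_zero] at hy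
        exact hy.not_gt hε)
    let ζ : C(X, ℂ) := ⟨fun z => (ξ z : ℂ), by fun_prop⟩
    have hζ : φ (g - ζ.comp p * g) x = φ g x := by
      have : ζ x = 0 := by simpa [ζ] using hξ0 rfl
      rw [map_sub, hφ]
      simp [this]
    have hnorm : ‖g - ζ.comp p * g‖ ≤ ε := by
      refine (ContinuousMap.norm_le _ hε.le).2 fun y => ?_
      have heq : (g - ζ.comp p * g) y = ((1 - ξ (p y) : ℝ) : ℂ) * g y := by
        simp [ζ]; ring
      rw [heq, norm_mul, Complex.norm_real, Real.norm_of_nonneg (by linarith [(hξ (p y)).2])]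
      by_cases hy : ε ≤ ‖g y‖
      · have : ξ (p y) = 1 := hξ1 (Set.mem_image_of_mem p hy)
        simp [this, hε.le]
      · push Not at hy
        nlinarith [(hξ (p y)).1, (hξ (p y)).2, norm_nonneg (g y)]
    calc ‖φ g x‖ = ‖φ (g - ζ.comp p * g) x‖ := by rw [hζ]
      _ ≤ ‖φ (g - ζ.comp p * g)‖ := ContinuousMap.norm_coe_le_norm _ _
      _ ≤ ‖φ‖ * ‖g - ζ.comp p * g‖ := φ.le_opNorm _
      _ ≤ ‖φ‖ * ε := by gcongr
  have hlim : Filter.Tendsto (fun ε : ℝ => ‖φ‖ * ε) (𝓝[>] 0) (𝓝 0) := by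
    have : Continuous fun ε : ℝ => ‖φ‖ * ε := by fun_prop
    simpa using (this.tendsto 0).mono_left nhdsWithin_le_nhds
  exact norm_le_zero_iff.1 (ge_of_tendsto hlim (eventually_nhdsWithin_of_forall key))

/-- If `C(Y, ℂ)` has a finite dual basis over `C(X, ℂ)`, then the fibers of `p` are finite. -/
theorem finite_fiber_of_dual_basis {X Y : Type*} [TopologicalSpace X] [TopologicalSpace Y]
    [CompactSpace Y] [T2Space Y] (p : C(Y, X)) {n : ℕ} (f : Fin n → C(Y, ℂ))
    (φ : Fin n → C(Y, ℂ) → C(X, ℂ))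
    (hsum : ∀ g : C(Y, ℂ), ∑ i, (φ i g).comp p * f i = g) (x : X) :
    (p ⁻¹' {x}).Finite := by
  by_contra hinf
  obtain ⟨s, hs, hcard⟩ := Set.Infinite.exists_subset_card_eq hinf (n + 1)
  let L : (Fin n → ℂ) →ₗ[ℂ] (s → ℂ) :=
    LinearMap.pi fun y => ∑ i, (f i y) • LinearMap.proj i
  have hL : Function.Surjective L := fun v => by
    classical
    obtain ⟨g, hg⟩ := exists_continuousMap_eqOn_finset s
      fun y => if hy : y ∈ s then v ⟨y, hy⟩ else 0
    refine ⟨fun i => φ i g x, funext fun y => ?_⟩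
    have hy : p y = x := hs y.2
    have := DFunLike.congr_fun (hsum g) (y : Y)
    simp only [ContinuousMap.sum_apply, ContinuousMap.mul_apply, ContinuousMap.comp_apply, hy,
      hg y y.2, y.2, dite_true] at this
    rw [← this]
    simp [L, mul_comm]
  have := L.finrank_le_finrank_of_surjective hL
  simp [hcard] at this

/-- If `C(Y, ℂ)` has a finite dual basis over `C(X, ℂ)`, the trace of multiplication by `g` is
the sum of `g` over the fibers of `p`. -/
theorem trace_eq_sum_fiber {X Y : Type*} [TopologicalSpace X] [TopologicalSpace Y]
    [CompactSpace X] [CompactSpace Y] [T2Space X] [T2Space Y] (p : C(Y, X)) {n : ℕ}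
    (f : Fin n → C(Y, ℂ)) (φ : Fin n → C(Y, ℂ) →L[ℂ] C(X, ℂ))
    (hφ : ∀ i (ξ : C(X, ℂ)) (g : C(Y, ℂ)), φ i (ξ.comp p * g) = ξ * φ i g)
    (hsum : ∀ g : C(Y, ℂ), ∑ i, (φ i g).comp p * f i = g) {x : X}
    (hfin : (p ⁻¹' {x}).Finite) (g : C(Y, ℂ)) :
    ∑ i, φ i (g * f i) x = ∑ y ∈ hfin.toFinset, g y := by
  classical
  choose e he using fun y : Y =>
    exists_continuousMap_eqOn_finset hfin.toFinset (Pi.single y (1 : ℂ))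
  have expand (i : Fin n) (h : C(Y, ℂ)) :
      φ i h x = ∑ y ∈ hfin.toFinset, h y * φ i (e y) x := by
    have h0 : φ i (h - ∑ y ∈ hfin.toFinset, h y • e y) x = 0 := by
      refine apply_eq_zero_of_eqOn_fiber p (φ i) (hφ i) fun y hy => ?_
      have hmem : y ∈ hfin.toFinset := by simpa using hy
      simp only [ContinuousMap.sub_apply, ContinuousMap.sum_apply, ContinuousMap.smul_apply,
        he _ y hmem, Pi.single_apply, smul_eq_mul, mul_ite, mul_one, mul_zero,
        Finset.sum_ite_eq, hmem, if_true, sub_self]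
    simpa [sub_eq_zero] using h0
  rw [Finset.sum_congr rfl fun i _ => expand i (g * f i), Finset.sum_comm]
  refine Finset.sum_congr rfl fun y hy => ?_
  have hyx : p y = x := by simpa using hy
  have := DFunLike.congr_fun (hsum (e y)) y
  simp only [ContinuousMap.sum_apply, ContinuousMap.mul_apply, ContinuousMap.comp_apply, hyx,
    he y y hy, Pi.single_eq_same] at this
  calc ∑ i, (g * f i) y * φ i (e y) x = g y * ∑ i, φ i (e y) x * f i y := by
        rw [Finset.mul_sum]
        exact Finset.sum_congr rfl fun i _ => by rw [ContinuousMap.mul_apply]; ring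
    _ = g y := by rw [this, mul_one]

/-- A continuous map with finite fibers between compact Hausdorff spaces is a covering map if
summation over the fibers preserves continuity. -/
theorem isCoveringMap_of_continuous_sum_fiber {X Y : Type*} [TopologicalSpace X]
    [TopologicalSpace Y] [CompactSpace Y] [T2Space X] [T2Space Y] (p : C(Y, X))
    (hfin : ∀ x, (p ⁻¹' {x}).Finite)
    (hcont : ∀ g : C(Y, ℝ), Continuous fun x => ∑ y ∈ (hfin x).toFinset, g y) :
    IsCoveringMap p := by
  classical
  have hopen : IsOpenMap p := by
    refine isOpenMap_iff_nhds_le.2 fun y s hs => ?_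
    obtain ⟨V, hVs, hV, hyV⟩ := mem_nhds_iff.1 (Filter.mem_map.1 hs)
    obtain ⟨g, hg0, hg1, hg⟩ := exists_continuous_zero_one_of_isClosed hV.isClosed_compl
      (isClosed_singleton (x := y)) (by simpa using hyV)
    have hpos : 0 < ∑ z ∈ (hfin (p y)).toFinset, g z :=
      Finset.sum_pos' (fun z _ => (hg z).1) ⟨y, by simp, by simp [hg1 rfl]⟩
    filter_upwards [(hcont g).continuousAt.eventually (lt_mem_nhds hpos)] with x hx
    obtain ⟨z, hz, hgz⟩ := Finset.exists_ne_zero_of_sum_ne_zero hx.ne'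
    have hzx : p z = x := by simpa using hz
    have hzV : z ∈ V := by
      by_contra hzV
      exact hgz (hg0 hzV)
    exact hzx ▸ hVs hzV
  refine isLocalHomeomorph_iff_isCoveringMap.1
    (isLocalHomeomorph_iff_isOpenEmbedding_restrict.2 fun y => ?_)
  obtain ⟨g, hg0, hg1, hg⟩ := exists_continuous_zero_one_of_isClosed
    ((hfin (p y)).subset Set.sdiff_subset : (p ⁻¹' {p y} \ {y}).Finite).isClosed
    (isClosed_singleton (x := y)) (by simp)
  have hone : ∑ z ∈ (hfin (p y)).toFinset, g z = 1 := by
    rw [Finset.sum_eq_single_of_mem y (by simp)]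
    · exact hg1 rfl
    · exact fun z hz hzy => hg0 ⟨by simpa using hz, hzy⟩
  let W : Set Y := {z | 3 / 4 < g z ∧ ∑ w ∈ (hfin (p z)).toFinset, g w < 5 / 4}
  have hW : IsOpen W := (isOpen_lt continuous_const g.continuous).inter
    (isOpen_lt ((hcont g).comp p.continuous) continuous_const)
  have hyW : y ∈ W := by
    refine ⟨?_, ?_⟩
    · rw [hg1 rfl]; norm_num
    · rw [hone]; norm_num
  refine ⟨W, hW.mem_nhds hyW, .of_continuous_injective_isOpenMap
    (p.continuous.comp continuous_subtype_val) ?_ (hopen.comp hW.isOpenMap_subtype_val)⟩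
  rintro ⟨a, ha⟩ ⟨b, hb⟩ hab
  replace hab : p a = p b := hab
  by_contra hne
  have hne' : a ≠ b := fun h => hne (Subtype.ext h)
  have hle : ∑ z ∈ {a, b}, g z ≤ ∑ z ∈ (hfin (p a)).toFinset, g z :=
    Finset.sum_le_sum_of_subset_of_nonneg
      (by simp [Set.insert_subset_iff, hab]) fun z _ _ => (hg z).1
  rw [Finset.sum_pair hne'] at hle
  linarith [ha.1, hb.1, ha.2]

/-- **Theorem.** Let `X`, `Y` be connected compact Hausdorff spaces and `p : Y → X` a
continuous surjection.  If `C(Y, ℂ)` is a finitely generated projective `C(X, ℂ)`-module,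
then `p` is a finite-fold covering map: every fiber is finite, all fibers have the same
cardinality, and `p` is a covering map. -/
theorem fg_projective_module_implies_covering
    {X Y : Type*} [TopologicalSpace X] [TopologicalSpace Y]
    [CompactSpace X] [CompactSpace Y] [T2Space X] [T2Space Y]
    [ConnectedSpace X] [ConnectedSpace Y]
    (p : C(Y, X)) (hsurj : Function.Surjective p) :
    letI := pullbackModule p
    Module.Finite C(X, ℂ) C(Y, ℂ) → Module.Projective C(X, ℂ) C(Y, ℂ) →
      (∀ x, (⇑p ⁻¹' {x}).Finite) ∧
      (∀ x₁ x₂, (⇑p ⁻¹' {x₁}).ncard = (⇑p ⁻¹' {x₂}).ncard) ∧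
      IsCoveringMap p := by
  intro hfg hproj
  obtain ⟨n, f, φ, hφ, hsum⟩ := exists_continuous_dual_basis p hfg hproj
  have hfin := finite_fiber_of_dual_basis p f (fun i => φ i) hsum
  have hcont (g : C(Y, ℝ)) : Continuous fun x => ∑ y ∈ (hfin x).toFinset, g y := by
    let gc : C(Y, ℂ) := ⟨fun y => (g y : ℂ), by fun_prop⟩
    have heq : (fun x => ∑ y ∈ (hfin x).toFinset, g y) =
        fun x => (∑ i, φ i (gc * f i) x).re := by
      funext x
      rw [trace_eq_sum_fiber p f φ hφ hsum (hfin x) gc]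
      simp [gc]
    rw [heq]
    fun_prop
  refine ⟨hfin, ?_, isCoveringMap_of_continuous_sum_fiber p hfin hcont⟩
  have hcard : Continuous fun x => (p ⁻¹' {x}).ncard := by
    refine Nat.isClosedEmbedding_coe_real.isEmbedding.continuous_iff.2 ?_
    convert hcont 1 using 2 with x
    simp [Set.ncard_eq_toFinset_card _ (hfin x)]
  exact fun x₁ x₂ => PreconnectedSpace.constant inferInstance hcard
end

section
/- Let B be a unital C*-algebra, A ⊆ B a C*-subalgebra containing the unit of B, and E : B → B a conditional expectation onto A: E is linear with range A, E(a) = a for all a ∈ A, E(a·b·a') = a·E(b)·a' for all a, a' ∈ A and b ∈ B, and E maps positive elements to positive elements. Let K ≥ 1 be a real number. Then the following are equivalent: (1) the map K·E − id_B is positive, i.e. K·E(b*b) − b*b ≥ 0 in B for every b ∈ B; (2) ‖b‖² ≤ K·‖E(b*b)‖ for every b ∈ B. -/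
open CFC in
/-- If `c * a * c ≤ r` for `c = h ^ (-1/2)` with `h` strictly positive, then `a ≤ r • h`. -/
lemma CStarAlgebra.le_smul_of_conjugate_rpow_neg_one_half_le {B : Type*} [CStarAlgebra B]
    [PartialOrder B] [StarOrderedRing B] {a h : B} (hh : IsStrictlyPositive h) {r : ℝ}
    (hle : h ^ (-(1 / 2) : ℝ) * a * h ^ (-(1 / 2) : ℝ) ≤ algebraMap ℝ B r) : a ≤ r • h := by
  have hdc : h ^ (1 / 2 : ℝ) * h ^ (-(1 / 2) : ℝ) = 1 := rpow_mul_rpow_neg _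
  have hcd : h ^ (-(1 / 2) : ℝ) * h ^ (1 / 2 : ℝ) = 1 := rpow_neg_mul_rpow _
  have hdd : h ^ (1 / 2 : ℝ) * h ^ (1 / 2 : ℝ) = h := by
    rw [← rpow_add hh.isUnit, add_halves, rpow_one h hh.nonneg]
  calc
    a = (h ^ (1 / 2 : ℝ) * h ^ (-(1 / 2) : ℝ)) * a * (h ^ (-(1 / 2) : ℝ) * h ^ (1 / 2 : ℝ)) := by
      rw [hdc, hcd, one_mul, mul_one]
    _ = h ^ (1 / 2 : ℝ) * (h ^ (-(1 / 2) : ℝ) * a * h ^ (-(1 / 2) : ℝ)) * h ^ (1 / 2 : ℝ) := by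
      simp only [mul_assoc]
    _ ≤ h ^ (1 / 2 : ℝ) * algebraMap ℝ B r * h ^ (1 / 2 : ℝ) :=
      conjugate_le_conjugate_of_nonneg hle rpow_nonneg
    _ = r • h := by
      rw [Algebra.algebraMap_eq_smul_one, mul_smul_comm, smul_mul_assoc, mul_one, hdd]

/-- A closed star subalgebra is stable under real powers of its positive elements. -/
lemma StarSubalgebra.rpow_mem_of_isClosed {B : Type*} [CStarAlgebra B]
    [PartialOrder B] [StarOrderedRing B] {A : StarSubalgebra ℂ B} (hA : IsClosed (A : Set B))
    {h : B} (hh : 0 ≤ h) (hmem : h ∈ A) (y : ℝ) : h ^ y ∈ A := by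
  have := hA
  rw [CFC.rpow_eq_cfc_real hh]
  exact cfc_mem (𝕜' := ℂ) _ hmem

/-- **Proposition.** Let `B` be a unital C*-algebra, `A ⊆ B` a C*-subalgebra containing the
unit, and `E : B → B` a (positive, unital) conditional expectation onto `A`.  For a real
`K ≥ 1` the following are equivalent: (1) `K·E − id` is positive, i.e.
`0 ≤ K·E(b*b) − b*b` for all `b`; (2) `‖b‖² ≤ K·‖E(b*b)‖` for all `b`. -/
theorem topological_index_finite_iff_norm_bound
    {B : Type*} [CStarAlgebra B] [PartialOrder B] [StarOrderedRing B]
    (A : StarSubalgebra ℂ B) (hA : IsClosed (A : Set B))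
    (E : B →ₗ[ℂ] B)
    (hrange : ∀ b, E b ∈ A)
    (hproj : ∀ a ∈ A, E a = a)
    (hbimod : ∀ a ∈ A, ∀ a' ∈ A, ∀ b, E (a * b * a') = a * E b * a')
    (hpos : ∀ b : B, 0 ≤ b → 0 ≤ E b)
    (K : ℝ) (hK : 1 ≤ K) :
    (∀ b : B, 0 ≤ (K : ℂ) • E (star b * b) - star b * b) ↔
    (∀ b : B, ‖b‖ ^ 2 ≤ K * ‖E (star b * b)‖) := by
  simp only [Complex.coe_smul, sub_nonneg]
  refine ⟨fun H b ↦ ?_, fun H b ↦ ?_⟩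
  · calc
      ‖b‖ ^ 2 = ‖star b * b‖ := by rw [CStarRing.norm_star_mul_self, sq]
      _ ≤ ‖K • E (star b * b)‖ :=
        CStarAlgebra.norm_le_norm_of_nonneg_of_le (star_mul_self_nonneg b) (H b)
      _ = K * ‖E (star b * b)‖ := by
        rw [norm_smul, Real.norm_of_nonneg (by positivity)]
  · have hE : 0 ≤ E (star b * b) := hpos _ (star_mul_self_nonneg b)
    have key : ∀ ε : ℝ, 0 < ε → star b * b ≤ K • (E (star b * b) + algebraMap ℝ B ε) := by
      intro ε hε
      set h := E (star b * b) + algebraMap ℝ B ε with hdef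
      have hεpos : IsStrictlyPositive (algebraMap ℝ B ε) := by grind
      have hh : IsStrictlyPositive h := hεpos.nonneg_add hE
      have hEh : E (star b * b) ≤ h := le_add_of_nonneg_right hεpos.nonneg
      have hmem : h ∈ A := by
        refine add_mem (hrange _) ?_
        rw [IsScalarTower.algebraMap_apply ℝ ℂ B]
        exact algebraMap_mem A _
      apply CStarAlgebra.le_smul_of_conjugate_rpow_neg_one_half_le hh
      have hcmem := StarSubalgebra.rpow_mem_of_isClosed hA hh.nonneg hmem (-(1 / 2))
      have hc1 := CFC.conjugate_rpow_neg_one_half h hh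
      have hc0 : 0 ≤ h ^ (-(1 / 2) : ℝ) := CFC.rpow_nonneg
      generalize h ^ (-(1 / 2) : ℝ) = c at *
      have hstar : star (b * c) * (b * c) = c * (star b * b) * c := by
        rw [star_mul, (IsSelfAdjoint.of_nonneg hc0).star_eq]
        simp only [mul_assoc]
      have hnn : 0 ≤ c * (star b * b) * c :=
        conjugate_nonneg_of_nonneg (star_mul_self_nonneg b) hc0
      rw [← CStarAlgebra.norm_le_iff_le_algebraMap _ (by positivity) hnn]
      have hcE : ‖c * E (star b * b) * c‖ ≤ 1 := by
        rw [CStarAlgebra.norm_le_one_iff_of_nonneg _ (conjugate_nonneg_of_nonneg hE hc0), ← hc1]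
        exact conjugate_le_conjugate_of_nonneg hEh hc0
      calc
        ‖c * (star b * b) * c‖ = ‖b * c‖ ^ 2 := by
          rw [← hstar, CStarRing.norm_star_mul_self, sq]
        _ ≤ K * ‖c * E (star b * b) * c‖ := by
          simpa only [hstar, hbimod c hcmem c hcmem] using H (b * c)
        _ ≤ K := mul_le_of_le_one_right (by positivity) hcE
    have hcont : Continuous fun ε : ℝ ↦ K • (E (star b * b) + algebraMap ℝ B ε) := by
      fun_prop
    have hlim := (hcont.tendsto 0).mono_left (nhdsWithin_le_nhds (s := Set.Ioi 0))
    rw [map_zero, add_zero] at hlim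
    exact ge_of_tendsto hlim (Filter.eventually_of_mem self_mem_nhdsWithin key)
end

section
/- Let X and Y be compact Hausdorff spaces, p : Y → X a continuous surjection, and E : C(Y,ℂ) → C(X,ℂ) a linear map satisfying: E(ξ∘p） = ξ for all ξ ∈ C(X,ℂ); E(f·(ξ∘p)) = E(f)·ξ for all f ∈ C(Y,ℂ), ξ ∈ C(X,ℂ); E maps nonnegative functions to nonnegative functions; and ‖E(f)‖ ≤ ‖f‖ for all f (E is a unital positive conditional expectation for the inclusion ξ ↦ ξ∘p). Then E is fiber-wise: for every x ∈ X and every f ∈ C(Y,ℂ) vanishing on the fiber p⁻¹(x), one has E(f)(x) = 0. -/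
open scoped ComplexOrder

/-- **Lemma.** Let `p : Y → X` be a continuous surjection of compact Hausdorff spaces and
`E : C(Y, ℂ) → C(X, ℂ)` a unital positive conditional expectation for the inclusion
`ξ ↦ ξ ∘ p`.  Then `E` is fiber-wise: if `f` vanishes on the fiber `p⁻¹(x)`, then
`E f x = 0`. -/
theorem conditional_expectation_fiberwise
    {X Y : Type*} [TopologicalSpace X] [TopologicalSpace Y]
    [CompactSpace X] [CompactSpace Y] [T2Space X] [T2Space Y]
    (p : C(Y, X)) (hsurj : Function.Surjective p)
    (E : C(Y, ℂ) →ₗ[ℂ] C(X, ℂ))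
    (hunital : ∀ ξ : C(X, ℂ), E (ξ.comp p) = ξ)
    (hmod : ∀ (f : C(Y, ℂ)) (ξ : C(X, ℂ)), E (f * ξ.comp p) = E f * ξ)
    (hpos : ∀ f : C(Y, ℂ), (∀ y, 0 ≤ f y) → ∀ x, 0 ≤ E f x)
    (hnorm : ∀ f : C(Y, ℂ), ‖E f‖ ≤ ‖f‖) :
    ∀ (x : X) (f : C(Y, ℂ)), (∀ y, p y = x → f y = 0) → E f x = 0 := by
  intro x f hf
  rw [← norm_le_zero_iff]
  refine le_of_forall_pos_le_add fun ε hε => ?_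
  rw [zero_add]
  have hK : IsClosed {y | ε ≤ ‖f y‖} := isClosed_le continuous_const (by fun_prop)
  have hpK : IsClosed (p '' {y | ε ≤ ‖f y‖}) := p.continuous.isClosedMap _ hK
  have hdisj : Disjoint (p '' {y | ε ≤ ‖f y‖}) {x} := by
    rw [Set.disjoint_singleton_right]
    rintro ⟨y, hy, rfl⟩
    rw [Set.mem_ofPred_eq, hf y rfl, norm_zero] at hy
    exact hε.not_ge hy
  obtain ⟨g, hg0, hg1, hg⟩ := exists_continuous_zero_one_of_isClosed hpK isClosed_singleton hdisj
  let ξ : C(X, ℂ) := ⟨fun z => (g z : ℂ), by fun_prop⟩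
  have hξ : ξ x = 1 := by simp [ξ, hg1 rfl]
  have hle : ‖f * ξ.comp p‖ ≤ ε := by
    refine (ContinuousMap.norm_le _ hε.le).2 fun y => ?_
    have hnorm_eq : ‖(f * ξ.comp p) y‖ = ‖f y‖ * g (p y) := by
      simp [ξ, abs_of_nonneg (hg (p y)).1]
    rw [hnorm_eq]
    by_cases hy : ε ≤ ‖f y‖
    · have : g (p y) = 0 := hg0 ⟨y, hy, rfl⟩
      simpa [this] using hε.le
    · exact (mul_le_of_le_one_right (norm_nonneg _) (hg (p y)).2).trans (not_le.1 hy).le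
  calc ‖E f x‖ = ‖E (f * ξ.comp p) x‖ := by rw [hmod, ContinuousMap.mul_apply, hξ, mul_one]
    _ ≤ ‖E (f * ξ.comp p)‖ := ContinuousMap.norm_coe_le_norm _ x
    _ ≤ ‖f * ξ.comp p‖ := hnorm _
    _ ≤ ε := hle
end

section
/- Let X and Y be compact Hausdorff spaces, p : Y → X a continuous surjection, and E : C(Y,ℂ) → C(X,ℂ) a unital positive conditional expectation for the inclusion ξ ↦ ξ∘p (i.e. E is linear, E(ξ∘p) = ξ, E(f·(ξ∘p)) = E(f)·ξ, and E maps nonnegative functions to nonnegative functions), which is topologically of index-finite type: there is a real number K ≥ 1 such that K·(E(f)∘p) − f ≥ 0 pointwise for every nonnegative f ∈ C(Y,ℂ). Then p is a branched covering: p is an open map, and every fiber p⁻¹(x) is finite with at most K elements (so the fiber cardinalities are uniformly bounded by K). -/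
open scoped ComplexOrder

section IndexFinite

variable {X Y : Type*} [TopologicalSpace X] [TopologicalSpace Y]

/-- A continuous function on a compact Hausdorff space separating a point from the complement of a
neighbourhood. -/
theorem exists_continuousMap_one_of_mem_isOpen [CompactSpace Y] [T2Space Y] {U : Set Y}
    (hU : IsOpen U) {y : Y} (hy : y ∈ U) :
    ∃ f : C(Y, ℝ), f y = 1 ∧ (∀ z, z ∉ U → f z = 0) ∧ ∀ z, 0 ≤ f z ∧ f z ≤ 1 := by
  obtain ⟨f, hf0, hf1, hf⟩ := exists_continuous_zero_one_of_isClosed hU.isClosed_compl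
    (isClosed_singleton (x := y)) (by simpa using hy)
  exact ⟨f, hf1 rfl, fun z hz => hf0 hz, hf⟩

theorem LinearMap.apply_le_of_le_const {e : C(Y, ℝ) →ₗ[ℝ] C(X, ℝ)} (hone : e 1 = 1)
    (hpos : ∀ f : C(Y, ℝ), (∀ y, 0 ≤ f y) → ∀ x, 0 ≤ e f x) {f : C(Y, ℝ)} {c : ℝ}
    (hf : ∀ y, f y ≤ c) (x : X) : e f x ≤ c := by
  have h := hpos (c • 1 - f) (by simpa using hf) x
  rw [map_sub, map_smul, hone] at h
  simpa using h

/-- A positive module map vanishes at a point as soon as the function vanishes on the fiber. -/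
theorem LinearMap.apply_nonpos_of_eq_zero_on_fiber [CompactSpace X] [CompactSpace Y] [T2Space X]
    (p : C(Y, X)) {e : C(Y, ℝ) →ₗ[ℝ] C(X, ℝ)} (hone : e 1 = 1)
    (hmod : ∀ (f : C(Y, ℝ)) (ξ : C(X, ℝ)), e (f * ξ.comp p) = e f * ξ)
    (hpos : ∀ f : C(Y, ℝ), (∀ y, 0 ≤ f y) → ∀ x, 0 ≤ e f x)
    {f : C(Y, ℝ)} {x : X} (hf : ∀ y, p y = x → f y = 0) : e f x ≤ 0 := by
  refine le_of_forall_pos_le_add fun ε hε => ?_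
  have hclosed : IsClosed (p '' {y | ε ≤ f y}) :=
    ((isClosed_le continuous_const f.continuous).isCompact.image p.continuous).isClosed
  obtain ⟨ξ, hξx, hξ, hξI⟩ := exists_continuousMap_one_of_mem_isOpen hclosed.isOpen_compl (y := x)
    (by
      rintro ⟨y, hy, hyx⟩
      have : ε ≤ f y := hy
      linarith [hf y hyx])
  have h := LinearMap.apply_le_of_le_const hone hpos (f := f * ξ.comp p) (c := ε) (fun y => by
    change f y * ξ (p y) ≤ ε
    by_cases hy : ε ≤ f y
    · rw [hξ (p y) (not_not.2 ⟨y, hy, rfl⟩), mul_zero]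
      exact hε.le
    · nlinarith [hξI (p y)]) x
  rw [hmod, ContinuousMap.mul_apply, hξx] at h
  linarith

theorem isOpenMap_of_index_finite [CompactSpace X] [CompactSpace Y] [T2Space X] [T2Space Y]
    (p : C(Y, X)) {e : C(Y, ℝ) →ₗ[ℝ] C(X, ℝ)} (hone : e 1 = 1)
    (hmod : ∀ (f : C(Y, ℝ)) (ξ : C(X, ℝ)), e (f * ξ.comp p) = e f * ξ)
    (hpos : ∀ f : C(Y, ℝ), (∀ y, 0 ≤ f y) → ∀ x, 0 ≤ e f x) {K : ℝ} (hK : 0 ≤ K)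
    (hindex : ∀ f : C(Y, ℝ), (∀ y, 0 ≤ f y) → ∀ y, f y ≤ K * e f (p y)) :
    IsOpenMap p := by
  intro U hU
  rw [isOpen_iff_mem_nhds]
  rintro _ ⟨y, hy, rfl⟩
  obtain ⟨f, hfy, hfU, hfI⟩ := exists_continuousMap_one_of_mem_isOpen hU hy
  have hfx : 0 < e f (p y) := by
    have := hindex f (fun z => (hfI z).1) y
    by_contra! hneg
    nlinarith
  filter_upwards [(isOpen_lt continuous_const (e f).continuous).mem_nhds hfx] with x hx
  by_contra hxU
  refine not_le_of_gt hx
    (LinearMap.apply_nonpos_of_eq_zero_on_fiber p hone hmod hpos fun z hz => hfU z fun hzU => ?_)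
  exact hxU ⟨z, hzU, hz⟩

theorem card_le_of_index_finite [CompactSpace Y] [T2Space Y]
    (p : C(Y, X)) {e : C(Y, ℝ) →ₗ[ℝ] C(X, ℝ)} (hone : e 1 = 1)
    (hpos : ∀ f : C(Y, ℝ), (∀ y, 0 ≤ f y) → ∀ x, 0 ≤ e f x) {K : ℝ} (hK : 0 ≤ K)
    (hindex : ∀ f : C(Y, ℝ), (∀ y, 0 ≤ f y) → ∀ y, f y ≤ K * e f (p y))
    {x : X} (s : Finset Y) (hs : ∀ y ∈ s, p y = x) : (s.card : ℝ) ≤ K := by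
  obtain ⟨U, hU, hdisj⟩ := s.finite_toSet.t2_separation
  choose f hfy hfU hfI using fun y => exists_continuousMap_one_of_mem_isOpen (hU y).2 (hU y).1
  have hsum : ∀ z, (∑ y ∈ s, f y) z ≤ 1 := by
    intro z
    rw [ContinuousMap.sum_apply]
    by_cases hz : ∃ y ∈ s, z ∈ U y
    · obtain ⟨y, hy, hzy⟩ := hz
      rw [Finset.sum_eq_single_of_mem y hy fun w hw hwy => hfU w z fun hzw =>
        Set.disjoint_left.1 (hdisj hw hy hwy) hzw hzy]
      exact (hfI y z).2
    · push Not at hz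
      rw [Finset.sum_eq_zero fun y hy => hfU y z (hz y hy)]
      exact zero_le_one
  have hle := LinearMap.apply_le_of_le_const hone hpos hsum x
  calc (s.card : ℝ) = ∑ y ∈ s, f y y := by simp [hfy]
    _ ≤ ∑ y ∈ s, K * e (f y) x := Finset.sum_le_sum fun y hy => by
        simpa only [hs y hy] using hindex (f y) (fun z => (hfI y z).1) y
    _ = K * e (∑ y ∈ s, f y) x := by
        rw [map_sum, ContinuousMap.sum_apply, Finset.mul_sum]
    _ ≤ K := mul_le_of_le_one_right hK hle

/-- The real part of a complex-linear map between spaces of continuous functions. -/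
noncomputable def LinearMap.realPartContinuousMap (E : C(Y, ℂ) →ₗ[ℂ] C(X, ℂ)) :
    C(Y, ℝ) →ₗ[ℝ] C(X, ℝ) where
  toFun f := ⟨fun x => (E ⟨fun y => (f y : ℂ), by fun_prop⟩ x).re, by fun_prop⟩
  map_add' f g := by
    ext x
    have : (⟨fun y => ((f + g) y : ℂ), by fun_prop⟩ : C(Y, ℂ)) =
        ⟨fun y => (f y : ℂ), by fun_prop⟩ + ⟨fun y => (g y : ℂ), by fun_prop⟩ := by
      ext y; simp
    rw [ContinuousMap.add_apply, ContinuousMap.coe_mk, this, map_add]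
    rfl
  map_smul' c f := by
    ext x
    have : (⟨fun y => ((c • f) y : ℂ), by fun_prop⟩ : C(Y, ℂ)) =
        (c : ℂ) • ⟨fun y => (f y : ℂ), by fun_prop⟩ := by
      ext y; simp
    rw [ContinuousMap.smul_apply, ContinuousMap.coe_mk, this, map_smul]
    exact Complex.re_ofReal_mul c _

theorem LinearMap.realPartContinuousMap_apply (E : C(Y, ℂ) →ₗ[ℂ] C(X, ℂ)) (f : C(Y, ℝ)) (x : X) :
    E.realPartContinuousMap f x = (E ⟨fun y => (f y : ℂ), by fun_prop⟩ x).re :=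
  rfl

end IndexFinite

/-- **Theorem.** Let `p : Y → X` be a continuous surjection of compact Hausdorff spaces and
`E : C(Y, ℂ) → C(X, ℂ)` a unital positive conditional expectation for the inclusion
`ξ ↦ ξ ∘ p` which is topologically of index-finite type: for some real `K ≥ 1` one has
`f ≤ K·(E f ∘ p)` pointwise for every nonnegative `f`.  Then `p` is a branched covering:
`p` is open and every fiber is finite with at most `K` elements. -/
theorem index_finite_expectation_implies_branched_covering
    {X Y : Type*} [TopologicalSpace X] [TopologicalSpace Y]
    [CompactSpace X] [CompactSpace Y] [T2Space X] [T2Space Y]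
    (p : C(Y, X)) (hsurj : Function.Surjective p)
    (E : C(Y, ℂ) →ₗ[ℂ] C(X, ℂ))
    (hunital : ∀ ξ : C(X, ℂ), E (ξ.comp p) = ξ)
    (hmod : ∀ (f : C(Y, ℂ)) (ξ : C(X, ℂ)), E (f * ξ.comp p) = E f * ξ)
    (hpos : ∀ f : C(Y, ℂ), (∀ y, 0 ≤ f y) → ∀ x, 0 ≤ E f x)
    (K : ℝ) (hK : 1 ≤ K)
    (hindex : ∀ f : C(Y, ℂ), (∀ y, 0 ≤ f y) → ∀ y, f y ≤ (K : ℂ) * E f (p y)) :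
    IsOpenMap p ∧
    ∀ x, (⇑p ⁻¹' {x}).Finite ∧ ((⇑p ⁻¹' {x}).ncard : ℝ) ≤ K := by
  have hone : E.realPartContinuousMap 1 = 1 := by
    ext x
    have h := congrArg (fun g : C(X, ℂ) => (g x).re) (hunital 1)
    rw [LinearMap.realPartContinuousMap_apply]
    have h1 : (⟨fun y => ((1 : C(Y, ℝ)) y : ℂ), by fun_prop⟩ : C(Y, ℂ)) =
        (1 : C(X, ℂ)).comp p := by
      ext y; simp
    rw [h1]
    simpa using h
  have hmod' : ∀ (f : C(Y, ℝ)) (ξ : C(X, ℝ)),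
      E.realPartContinuousMap (f * ξ.comp p) = E.realPartContinuousMap f * ξ := by
    intro f ξ
    ext x
    rw [ContinuousMap.mul_apply, LinearMap.realPartContinuousMap_apply,
      LinearMap.realPartContinuousMap_apply]
    have h1 : (⟨fun y => ((f * ξ.comp p) y : ℂ), by fun_prop⟩ : C(Y, ℂ)) =
        ⟨fun y => (f y : ℂ), by fun_prop⟩ *
          (⟨fun x => (ξ x : ℂ), by fun_prop⟩ : C(X, ℂ)).comp p := by
      ext y; simp
    rw [h1, hmod]
    simp
  have hpos' : ∀ f : C(Y, ℝ), (∀ y, 0 ≤ f y) → ∀ x, 0 ≤ E.realPartContinuousMap f x :=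
    fun f hf x => (Complex.le_def.1 (hpos _ (fun y => Complex.zero_le_real.2 (hf y)) x)).1
  have hindex' : ∀ f : C(Y, ℝ), (∀ y, 0 ≤ f y) →
      ∀ y, f y ≤ K * E.realPartContinuousMap f (p y) := by
    intro f hf y
    have h := (Complex.le_def.1 (hindex ⟨fun y => (f y : ℂ), by fun_prop⟩
      (fun y => Complex.zero_le_real.2 (hf y)) y)).1
    rw [Complex.re_ofReal_mul] at h
    exact h
  have hK0 : 0 ≤ K := zero_le_one.trans hK
  refine ⟨isOpenMap_of_index_finite p hone hmod' hpos' hK0 hindex', fun x => ?_⟩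
  have hcard := card_le_of_index_finite p hone hpos' hK0 hindex' (x := x)
  have hfin : (⇑p ⁻¹' {x}).Finite := by
    by_contra hinf
    obtain ⟨n, hn⟩ := exists_nat_gt K
    obtain ⟨s, hs, hsn⟩ := Set.Infinite.exists_subset_card_eq hinf n
    have := hcard s fun y hy => hs hy
    rw [hsn] at this
    exact not_le_of_gt hn this
  refine ⟨hfin, ?_⟩
  rw [Set.ncard_eq_toFinset_card _ hfin]
  exact hcard _ fun y hy => by simpa using hy
end
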